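/- Let c > 0 and z ∈ ℂ with Im(z) > 0, and let s(z) be the Stieltjes transform of the Marchenko–Pastur distribution μ_c with parameter c. Then S(z) = c·s(z) satisfies the equation S/(1+S) − zS = c, i.e., zS² + (z−1+c)S + c = 0. -/

import Mathlib

open MeasureTheory Real

/-- The Marchenko–Pastur distribution with parameter `c > 0`:
`(1 - 1/c)⁺ δ₀ + (√((b-x)(x-a)) / (2πcx)) 1_{[a,b]}(x) dx`
with `a = (1 - √c)²`, `b = (1 + √c)²`. -/
noncomputable def marchenkoPastur (c : ℝ) : Measure ℝ :=
  ENNReal.ofReal (1 - 1 / c) • Measure.dirac 0 +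
    volume.withDensity (fun x =>
      ENNReal.ofReal
        (if x ∈ Set.Icc ((1 - Real.sqrt c) ^ 2) ((1 + Real.sqrt c) ^ 2) then
          Real.sqrt (((1 + Real.sqrt c) ^ 2 - x) * (x - (1 - Real.sqrt c) ^ 2)) /
            (2 * Real.pi * c * x)
        else 0))

/-- The Stieltjes transform of the Marchenko–Pastur law. -/
noncomputable def mpStieltjes (c : ℝ) (z : ℂ) : ℂ :=
  ∫ l : ℝ, ((l : ℂ) - z)⁻¹ ∂(marchenkoPastur c)

theorem one_add_sq_sub_two_mul_cos_eq (m : ℂ) (θ : ℝ) :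
    1 + m ^ 2 - 2 * m * (Real.cos θ : ℂ) =
      (1 - m * Complex.exp (θ * Complex.I)) * (1 - m * Complex.exp (-(θ * Complex.I))) := by
  have h : Complex.exp (θ * Complex.I) * Complex.exp (-(θ * Complex.I)) = 1 := by
    rw [← Complex.exp_add]; simp
  rw [Complex.ofReal_cos, Complex.cos, neg_mul]
  linear_combination (-m ^ 2) * h

theorem one_sub_mul_ne_zero_of_norm {m w : ℂ} (hm : ‖m‖ < 1) (hw : ‖w‖ ≤ 1) : 1 - m * w ≠ 0 := by
  intro h
  have h1 : ‖m * w‖ = 1 := by rw [← sub_eq_zero.1 h, norm_one]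
  rw [norm_mul] at h1
  nlinarith [norm_nonneg m, norm_nonneg w]

theorem one_add_sq_sub_two_mul_cos_ne_zero {m : ℂ} (hm : ‖m‖ < 1) (θ : ℝ) :
    1 + m ^ 2 - 2 * m * (Real.cos θ : ℂ) ≠ 0 := by
  rw [one_add_sq_sub_two_mul_cos_eq]
  refine mul_ne_zero (one_sub_mul_ne_zero_of_norm hm ?_) (one_sub_mul_ne_zero_of_norm hm ?_)
  · rw [Complex.norm_exp_ofReal_mul_I]
  · rw [← neg_mul, ← Complex.ofReal_neg, Complex.norm_exp_ofReal_mul_I]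

theorem integral_one_sub_exp_sq_div {m : ℂ} (hm : ‖m‖ < 1) :
    ∫ θ in (0 : ℝ)..2 * π, (1 - Complex.exp (θ * Complex.I) ^ 2) /
      (1 + m ^ 2 - 2 * m * (Real.cos θ : ℂ)) = 2 * (π : ℂ) := by
  have hd : DiffContOnCl ℂ (fun ζ : ℂ => (1 - ζ ^ 2) / (1 - m * ζ)) (Metric.ball 0 1) := by
    apply DifferentiableOn.diffContOnCl
    rw [closure_ball _ one_ne_zero]
    intro ζ hζ
    have : 1 - m * ζ ≠ 0 := one_sub_mul_ne_zero_of_norm hm (by simpa using hζ)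
    exact DifferentiableAt.differentiableWithinAt (by fun_prop (disch := assumption))
  have hC := hd.circleIntegral_sub_inv_smul (w := m) (by simpa using hm)
  have hm2 : 1 - m ^ 2 ≠ 0 := by
    simpa [sq] using one_sub_mul_ne_zero_of_norm hm hm.le
  rw [circleIntegral, ← pow_two, div_self hm2] at hC
  have hI : ∫ θ in (0 : ℝ)..2 * π, (1 - Complex.exp (θ * Complex.I) ^ 2) /
      (1 + m ^ 2 - 2 * m * (Real.cos θ : ℂ)) * Complex.I = 2 * π * Complex.I := by
    rw [smul_eq_mul, mul_one] at hC
    rw [← hC]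
    refine intervalIntegral.integral_congr fun θ _ => ?_
    have hD := one_add_sq_sub_two_mul_cos_ne_zero hm θ
    simp only [deriv_circleMap, circleMap, Complex.ofReal_one, one_mul, zero_add, smul_eq_mul]
    rw [one_add_sq_sub_two_mul_cos_eq] at hD ⊢
    have h1 := left_ne_zero_of_mul hD
    have h2 := right_ne_zero_of_mul hD
    rw [Complex.exp_neg] at h2 ⊢
    have h0 := Complex.exp_ne_zero (θ * Complex.I)
    set e := Complex.exp (θ * Complex.I)
    have h3 : e - m ≠ 0 := by
      intro h; apply h2; rw [← sub_eq_zero.1 h]; simp [h0]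
    field_simp
  rw [intervalIntegral.integral_mul_const] at hI
  exact mul_right_cancel₀ Complex.I_ne_zero hI

/-- The integral `∫₀^π sin² θ / (1 + m² - 2 m cos θ) dθ` does not depend on `m` in the unit disc. -/
theorem integral_sin_sq_div {m : ℂ} (hm : ‖m‖ < 1) :
    ∫ θ in (0 : ℝ)..π, (Real.sin θ : ℂ) ^ 2 / (1 + m ^ 2 - 2 * m * (Real.cos θ : ℂ)) = (π : ℂ) / 2 := by
  have hA := integral_one_sub_exp_sq_div hm
  set F : ℝ → ℂ := fun θ => (1 - Complex.exp (θ * Complex.I) ^ 2) /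
      (1 + m ^ 2 - 2 * m * (Real.cos θ : ℂ)) with hF
  have hc : Continuous F := by
    have := one_add_sq_sub_two_mul_cos_ne_zero hm
    exact Continuous.div (by fun_prop) (by fun_prop) this
  have hr : ∫ θ in π..2 * π, F θ = ∫ θ in (0 : ℝ)..π, F (2 * π - θ) := by
    rw [intervalIntegral.integral_comp_sub_left]
    congr 1 <;> ring
  have hc' : Continuous fun θ => F (2 * π - θ) := hc.comp (by fun_prop)
  rw [← intervalIntegral.integral_add_adjacent_intervals (hc.intervalIntegrable 0 π)
    (hc.intervalIntegrable π _), hr, ← intervalIntegral.integral_add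
    (hc.intervalIntegrable _ _) (hc'.intervalIntegrable _ _)] at hA
  have hs : ∀ θ : ℝ, F θ + F (2 * π - θ) =
      4 * ((Real.sin θ : ℂ) ^ 2 / (1 + m ^ 2 - 2 * m * (Real.cos θ : ℂ))) := by
    intro θ
    have he : Complex.exp (((2 * π - θ : ℝ) : ℂ) * Complex.I)
        = Complex.exp (-(θ * Complex.I)) := by
      rw [← Complex.exp_periodic.sub_eq' (x := (θ : ℂ) * Complex.I)]
      push_cast; congr 1; ring
    have h1 : Complex.exp (θ * Complex.I) * Complex.exp (-(θ * Complex.I)) = 1 := by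
      rw [← Complex.exp_add]; simp
    simp only [hF, Real.cos_two_pi_sub, he]
    rw [← add_div, mul_div_assoc']
    congr 1
    rw [Complex.ofReal_sin, Complex.sin, neg_mul]
    linear_combination (-(Complex.exp (-(θ * Complex.I)) - Complex.exp (θ * Complex.I)) ^ 2) *
      Complex.I_sq - 2 * h1
  rw [intervalIntegral.integral_congr (fun θ _ => hs θ), intervalIntegral.integral_const_mul] at hA
  linear_combination hA / 4

/-- The edge case `m = -1` of `integral_sin_sq_div`. -/
theorem integral_sin_sq_div_two_add_two_cos :
    ∫ θ in (0 : ℝ)..π, (Real.sin θ : ℂ) ^ 2 / (2 + 2 * (Real.cos θ : ℂ)) = (π : ℂ) / 2 := by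
  have h : ∫ θ in (0 : ℝ)..π, (Real.sin θ : ℂ) ^ 2 / (2 + 2 * (Real.cos θ : ℂ)) =
      ∫ θ in (0 : ℝ)..π, (((1 - Real.cos θ) / 2 : ℝ) : ℂ) := by
    rw [intervalIntegral.integral_of_le pi_pos.le, intervalIntegral.integral_of_le pi_pos.le,
      integral_Ioc_eq_integral_Ioo, integral_Ioc_eq_integral_Ioo]
    refine setIntegral_congr_fun measurableSet_Ioo fun θ hθ => ?_
    have h0 : (2 + 2 * Real.cos θ) ≠ 0 := by
      have := Real.strictAntiOn_cos ⟨hθ.1.le, hθ.2.le⟩ ⟨pi_pos.le, le_rfl⟩ hθ.2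
      rw [Real.cos_pi] at this
      linarith
    have h1 : Real.sin θ ^ 2 / (2 + 2 * Real.cos θ) = (1 - Real.cos θ) / 2 := by
      rw [Real.sin_sq, div_eq_div_iff h0 two_ne_zero]; ring
    simp only [← h1]
    push_cast
    rfl
  rw [h, intervalIntegral.integral_ofReal, intervalIntegral.integral_div,
    intervalIntegral.integral_sub (by simp) (by simp)]
  simp

/-- The substitution `x = 1 + c + 2 √c cos θ` parametrizes the support of `marchenkoPastur c`. -/
noncomputable def mpAngle (c θ : ℝ) : ℝ := 1 + c + 2 * √c * Real.cos θ

theorem mpAngle_pos {c θ : ℝ} (hc : 0 < c) (hθ : θ ∈ Set.Ioo 0 π) : 0 < mpAngle c θ := by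
  have := Real.strictAntiOn_cos ⟨hθ.1.le, hθ.2.le⟩ ⟨pi_pos.le, le_rfl⟩ hθ.2
  rw [Real.cos_pi] at this
  have h2 := Real.sq_sqrt hc.le
  have h3 := Real.sqrt_pos.2 hc
  unfold mpAngle
  nlinarith [sq_nonneg (1 - √c), mul_pos h3 (show 0 < 1 + Real.cos θ by linarith)]

/-- The value of `∫₀^π sin² θ / x(θ) dθ`, where `x(θ) = 1 + c + 2 √c cos θ`. -/
theorem integral_sin_sq_div_mpAngle {c : ℝ} (hc : 0 < c) :
    ∫ θ in (0 : ℝ)..π, (Real.sin θ : ℂ) ^ 2 / (mpAngle c θ : ℂ) =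
      ((π / 2 * min 1 (1 / c) : ℝ) : ℂ) := by
  have h2 := Real.sq_sqrt hc.le
  have h3 := Real.sqrt_pos.2 hc
  have h2C : (√c : ℂ) ^ 2 = c := by exact_mod_cast h2
  have h3C : (√c : ℂ) ≠ 0 := by exact_mod_cast h3.ne'
  rcases lt_trichotomy c 1 with h | h | h
  · have hm : ‖(-(√c : ℂ) : ℂ)‖ < 1 := by
      rw [norm_neg, Complex.norm_real, Real.norm_of_nonneg h3.le]
      nlinarith
    rw [min_eq_left (by rw [le_div_iff₀ hc]; linarith)]
    have := integral_sin_sq_div hm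
    push_cast
    rw [mul_one, ← this]
    refine intervalIntegral.integral_congr fun θ _ => ?_
    simp only [mpAngle]
    push_cast
    rw [← h2C]
    congr 1
    ring
  · subst h
    simp only [mpAngle]
    convert integral_sin_sq_div_two_add_two_cos using 2
    · ext θ
      norm_num
    · simp
  · have hm : ‖(-(√c : ℂ)⁻¹ : ℂ)‖ < 1 := by
      rw [norm_neg, norm_inv, Complex.norm_real, Real.norm_of_nonneg h3.le]
      exact inv_lt_one_of_one_lt₀ (by nlinarith)
    rw [min_eq_right (by rw [div_le_iff₀ hc]; linarith)]
    have := integral_sin_sq_div hm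
    push_cast
    rw [← this, ← intervalIntegral.integral_mul_const]
    refine intervalIntegral.integral_congr fun θ _ => ?_
    simp only [mpAngle]
    push_cast
    rw [div_mul_div_comm, mul_one]
    congr 1
    rw [← h2C]
    field_simp
    ring

/-- A non-real complex number is of the form `m + m⁻¹` with `m` in the punctured unit disc. -/
theorem exists_norm_lt_one_add_inv {β : ℂ} (hβ : β.im ≠ 0) :
    ∃ m : ℂ, m ≠ 0 ∧ ‖m‖ < 1 ∧ m + m⁻¹ = β := by
  obtain ⟨d, hd⟩ := IsAlgClosed.exists_pow_nat_eq (β ^ 2 - 4) two_pos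
  set r := (β + d) / 2 with hr
  have hrr : r * (β - r) = 1 := by rw [hr]; linear_combination -hd / 4
  have h0 : r ≠ 0 := left_ne_zero_of_mul_eq_one hrr
  have hi : r⁻¹ = β - r := inv_eq_of_mul_eq_one_right hrr
  have hsum : r + r⁻¹ = β := by rw [hi]; ring
  rcases lt_trichotomy ‖r‖ 1 with h | h | h
  · exact ⟨r, h0, h, hsum⟩
  · exfalso
    apply hβ
    rw [← hsum, Complex.inv_eq_conj h]
    simp
  · refine ⟨r⁻¹, inv_ne_zero h0, ?_, by rw [inv_inv, add_comm, hsum]⟩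
    rw [norm_inv]
    exact inv_lt_one_of_one_lt₀ h

theorem ofReal_sub_ne_zero_of_im {z : ℂ} (hz : 0 < z.im) (x : ℝ) : (x : ℂ) - z ≠ 0 := by
  intro h
  have := congrArg Complex.im h
  simp at this
  exact hz.ne' this

theorem integral_sin_sq_div_mpAngle_sub {c : ℝ} (hc : 0 < c) {z : ℂ} (hz : 0 < z.im) :
    ∃ m : ℂ, √c * (1 + m ^ 2) = m * (z - 1 - c) ∧
      ∫ θ in (0 : ℝ)..π, (Real.sin θ : ℂ) ^ 2 / ((mpAngle c θ : ℂ) - z) = -m / √c * (π / 2) := by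
  have h3 := Real.sqrt_pos.2 hc
  have h3C : (√c : ℂ) ≠ 0 := by exact_mod_cast h3.ne'
  have hβ : ((z - 1 - c) / √c).im ≠ 0 := by
    rw [Complex.div_ofReal_im]
    simp [hz.ne', h3.ne']
  obtain ⟨m, hm0, hm, hmβ⟩ := exists_norm_lt_one_add_inv hβ
  have hq : √c * (1 + m ^ 2) = m * (z - 1 - c) := by
    field_simp at hmβ
    linear_combination hmβ
  refine ⟨m, hq, ?_⟩
  rw [← integral_sin_sq_div hm, ← intervalIntegral.integral_const_mul]
  refine intervalIntegral.integral_congr fun θ _ => ?_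
  have hD := one_add_sq_sub_two_mul_cos_ne_zero hm θ
  have hx : ((mpAngle c θ : ℂ) - z) =
      -√c / m * (1 + m ^ 2 - 2 * m * (Real.cos θ : ℂ)) := by
    simp only [mpAngle]
    push_cast at hD ⊢
    field_simp
    linear_combination hq
  simp only [hx]
  field_simp

/-- The density of the absolutely continuous part of `marchenkoPastur c`. -/
noncomputable def mpDensity (c x : ℝ) : ℝ :=
  if x ∈ Set.Icc ((1 - √c) ^ 2) ((1 + √c) ^ 2) then
    √(((1 + √c) ^ 2 - x) * (x - (1 - √c) ^ 2)) / (2 * π * c * x)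
  else 0

theorem mpDensity_nonneg {c : ℝ} (hc : 0 < c) (x : ℝ) : 0 ≤ mpDensity c x := by
  unfold mpDensity
  split_ifs with h
  · have : 0 ≤ x := (sq_nonneg _).trans h.1
    positivity
  · rfl

theorem measurable_mpDensity (c : ℝ) : Measurable (mpDensity c) :=
  Measurable.ite measurableSet_Icc (by fun_prop) measurable_const

theorem image_mpAngle {c : ℝ} (hc : 0 < c) :
    mpAngle c '' Set.Icc 0 π = Set.Icc ((1 - √c) ^ 2) ((1 + √c) ^ 2) := by
  have h2 := Real.sq_sqrt hc.le
  have h3 := Real.sqrt_pos.2 hc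
  have : mpAngle c = (fun u => (2 * √c) * u + (1 + c)) ∘ Real.cos := by
    ext θ; simp only [mpAngle, Function.comp]; ring
  rw [this, Set.image_comp, Real.bijOn_cos.image_eq, Set.image_affine_Icc' (by positivity)]
  congr 1 <;> linear_combination -h2

theorem injOn_mpAngle {c : ℝ} (hc : 0 < c) : Set.InjOn (mpAngle c) (Set.Icc 0 π) := by
  intro x hx y hy h
  have h3 := Real.sqrt_pos.2 hc
  refine Real.injOn_cos hx hy ?_
  simpa [mpAngle, h3.ne'] using h

theorem hasDerivAt_mpAngle (c θ : ℝ) :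
    HasDerivAt (mpAngle c) (2 * √c * -Real.sin θ) θ :=
  ((Real.hasDerivAt_cos θ).const_mul _).const_add _

theorem abs_deriv_mul_mpDensity_mpAngle {c θ : ℝ} (hc : 0 < c) (hθ : θ ∈ Set.Icc 0 π) :
    |2 * √c * -Real.sin θ| * mpDensity c (mpAngle c θ) =
      2 / π * (Real.sin θ ^ 2 / mpAngle c θ) := by
  have h2 := Real.sq_sqrt hc.le
  have h3 := Real.sqrt_pos.2 hc
  have hs := Real.sin_nonneg_of_mem_Icc hθ
  have hmem : mpAngle c θ ∈ Set.Icc ((1 - √c) ^ 2) ((1 + √c) ^ 2) :=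
    image_mpAngle hc ▸ Set.mem_image_of_mem _ hθ
  have hsq : ((1 + √c) ^ 2 - mpAngle c θ) * (mpAngle c θ - (1 - √c) ^ 2) =
      (2 * √c * Real.sin θ) ^ 2 := by
    have h5 : (1 + √c) ^ 2 - mpAngle c θ = 2 * √c * (1 - Real.cos θ) := by
      unfold mpAngle; linear_combination h2
    have h6 : mpAngle c θ - (1 - √c) ^ 2 = 2 * √c * (1 + Real.cos θ) := by
      unfold mpAngle; linear_combination -h2
    rw [h5, h6, mul_pow, Real.sin_sq]
    ring
  rw [mpDensity, if_pos hmem, hsq, Real.sqrt_sq (by positivity), mul_neg, abs_neg,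
    abs_of_nonneg (by positivity)]
  have h7 : 2 * √c * Real.sin θ * (2 * √c * Real.sin θ) = 4 * c * Real.sin θ ^ 2 := by
    linear_combination 4 * Real.sin θ ^ 2 * h2
  rw [mul_div_assoc', h7]
  field_simp
  ring

theorem continuous_mpAngle (c : ℝ) : Continuous (mpAngle c) := by
  unfold mpAngle; fun_prop

theorem intervalIntegrable_sin_sq_div_mpAngle {c : ℝ} (hc : 0 < c) :
    IntervalIntegrable (fun θ => Real.sin θ ^ 2 / mpAngle c θ) volume 0 π := by
  have h3 := Real.sqrt_pos.2 hc
  rw [intervalIntegrable_iff_integrableOn_Ioo_of_le pi_pos.le]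
  refine Measure.integrableOn_of_bounded (M := (√c)⁻¹) (by simp) ?_ ?_
  · have hm : Measurable (mpAngle c) := (continuous_mpAngle c).measurable
    exact (Measurable.div (by fun_prop) hm).aestronglyMeasurable
  · refine (ae_restrict_iff' measurableSet_Ioo).2 (.of_forall fun θ hθ => ?_)
    have hx := mpAngle_pos hc hθ
    rw [Real.norm_of_nonneg (by positivity), div_le_iff₀ hx, inv_mul_eq_div, le_div_iff₀ h3]
    have h2 := Real.sq_sqrt hc.le
    unfold mpAngle
    rw [Real.sin_sq]
    nlinarith [sq_nonneg (1 - √c), mul_nonneg h3.le (sq_nonneg (1 + Real.cos θ))]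

theorem integrable_mpDensity {c : ℝ} (hc : 0 < c) : Integrable (mpDensity c) := by
  have hsupp : Function.support (mpDensity c) ⊆ Set.Icc ((1 - √c) ^ 2) ((1 + √c) ^ 2) := by
    intro x hx
    by_contra h
    exact hx (if_neg h)
  rw [← integrableOn_iff_integrable_of_support_subset hsupp, ← image_mpAngle hc,
    integrableOn_image_iff_integrableOn_abs_deriv_smul measurableSet_Icc
      (fun θ _ => (hasDerivAt_mpAngle c θ).hasDerivWithinAt) (injOn_mpAngle hc),
    integrableOn_Icc_iff_integrableOn_Ioo]
  have h := (intervalIntegrable_iff_integrableOn_Ioo_of_le pi_pos.le).1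
    (intervalIntegrable_sin_sq_div_mpAngle hc)
  refine IntegrableOn.congr_fun (h.const_mul (2 / π)) (fun θ hθ => ?_) measurableSet_Ioo
  exact (abs_deriv_mul_mpDensity_mpAngle hc (Set.Ioo_subset_Icc_self hθ)).symm

theorem integral_withDensity_mpDensity {c : ℝ} (hc : 0 < c) (g : ℝ → ℂ) :
    ∫ x, g x ∂(volume.withDensity fun x => ENNReal.ofReal (mpDensity c x)) =
      ∫ θ in (0 : ℝ)..π, 2 / π * ((Real.sin θ : ℂ) ^ 2 / (mpAngle c θ : ℂ)) * g (mpAngle c θ) := by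
  rw [integral_withDensity_eq_integral_toReal_smul
    (measurable_mpDensity c).ennreal_ofReal (.of_forall fun _ => ENNReal.ofReal_lt_top)]
  simp only [ENNReal.toReal_ofReal (mpDensity_nonneg hc _)]
  rw [← setIntegral_eq_integral_of_forall_compl_eq_zero
    (s := Set.Icc ((1 - √c) ^ 2) ((1 + √c) ^ 2))
    (fun x hx => by rw [mpDensity, if_neg hx, zero_smul]), ← image_mpAngle hc,
    integral_image_eq_integral_abs_deriv_smul measurableSet_Icc
      (fun θ _ => (hasDerivAt_mpAngle c θ).hasDerivWithinAt) (injOn_mpAngle hc),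
    intervalIntegral.integral_of_le pi_pos.le, ← integral_Icc_eq_integral_Ioc]
  refine setIntegral_congr_fun measurableSet_Icc fun θ hθ => ?_
  simp only [← smul_assoc, smul_eq_mul]
  rw [abs_deriv_mul_mpDensity_mpAngle hc hθ, Complex.real_smul]
  push_cast
  rfl

theorem integrable_inv_sub {z : ℂ} (hz : 0 < z.im) (μ : Measure ℝ) [IsFiniteMeasure μ] :
    Integrable (fun l : ℝ => ((l : ℂ) - z)⁻¹) μ := by
  refine Integrable.of_bound ?_ (z.im)⁻¹ (.of_forall fun l => ?_)
  · exact (Measurable.inv (by fun_prop)).aestronglyMeasurable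
  · rw [norm_inv]
    refine inv_anti₀ hz ?_
    have := Complex.abs_im_le_norm ((l : ℂ) - z)
    simpa [abs_of_pos hz] using this

/-- A rational parametrization of `mpStieltjes c z` by a root `m` of a quadratic equation. -/
theorem mul_mpStieltjes_eq {c : ℝ} (hc : 0 < c) {z : ℂ} (hz : 0 < z.im) :
    ∃ m : ℂ, √c * (1 + m ^ 2) = m * (z - 1 - c) ∧
      z * mpStieltjes c z = -m / √c - 1 := by
  obtain ⟨m, hq, hm⟩ := integral_sin_sq_div_mpAngle_sub hc hz
  refine ⟨m, hq, ?_⟩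
  have hz0 : z ≠ 0 := by rintro rfl; simp at hz
  have hpi : (π : ℂ) ≠ 0 := by exact_mod_cast pi_ne_zero
  have := isFiniteMeasure_withDensity_ofReal (integrable_mpDensity hc).hasFiniteIntegral
  have hsplit : mpStieltjes c z = (max (1 - 1 / c) 0 : ℝ) * (-z⁻¹) +
      ∫ x : ℝ, ((x : ℂ) - z)⁻¹ ∂(volume.withDensity fun x => ENNReal.ofReal (mpDensity c x)) := by
    have h : marchenkoPastur c = ENNReal.ofReal (1 - 1 / c) • Measure.dirac 0 +
        volume.withDensity (fun x => ENNReal.ofReal (mpDensity c x)) := rfl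
    have := (Measure.dirac (0 : ℝ)).smul_finite (c := ENNReal.ofReal (1 - 1 / c))
      ENNReal.ofReal_ne_top
    rw [mpStieltjes, h, integral_add_measure (integrable_inv_sub hz _) (integrable_inv_sub hz _),
      integral_smul_measure, integral_dirac, ENNReal.toReal_ofReal', Complex.real_smul]
    simp [inv_neg]
  have hint : ∫ x : ℝ, ((x : ℂ) - z)⁻¹
        ∂(volume.withDensity fun x => ENNReal.ofReal (mpDensity c x)) =
      2 / π * z⁻¹ * (-m / √c * (π / 2) - ((π / 2 * min 1 (1 / c) : ℝ) : ℂ)) := by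
    have hi : IntervalIntegrable
        (fun θ => (Real.sin θ : ℂ) ^ 2 / (mpAngle c θ : ℂ)) volume 0 π := by
      have h := intervalIntegrable_sin_sq_div_mpAngle hc
      exact_mod_cast (⟨h.1.integrable.ofReal, h.2.integrable.ofReal⟩ : IntervalIntegrable
        (fun θ => ((Real.sin θ ^ 2 / mpAngle c θ : ℝ) : ℂ)) volume 0 π)
    have hi' : IntervalIntegrable
        (fun θ => (Real.sin θ : ℂ) ^ 2 / ((mpAngle c θ : ℂ) - z)) volume 0 π := by
      have := continuous_mpAngle c
      exact (Continuous.div (by fun_prop) (by fun_prop)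
        fun θ => ofReal_sub_ne_zero_of_im hz _).intervalIntegrable _ _
    rw [integral_withDensity_mpDensity hc, ← hm, ← integral_sin_sq_div_mpAngle hc,
      ← intervalIntegral.integral_sub hi' hi, ← intervalIntegral.integral_const_mul,
      intervalIntegral.integral_of_le pi_pos.le, intervalIntegral.integral_of_le pi_pos.le,
      integral_Ioc_eq_integral_Ioo, integral_Ioc_eq_integral_Ioo]
    refine setIntegral_congr_fun measurableSet_Ioo fun θ hθ => ?_
    have hx : (mpAngle c θ : ℂ) ≠ 0 := by exact_mod_cast (mpAngle_pos hc hθ).ne'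
    have hxz := ofReal_sub_ne_zero_of_im hz (mpAngle c θ)
    field_simp
    ring
  have hmass : max (1 - 1 / c) 0 + min 1 (1 / c) = 1 := by
    rcases le_total 1 (1 / c) with h | h
    · rw [min_eq_left h, max_eq_right (by linarith)]; ring
    · rw [min_eq_right h, max_eq_left (by linarith)]; ring
  have hmassC : ((max (1 - 1 / c) 0 : ℝ) : ℂ) + ((min 1 (1 / c) : ℝ) : ℂ) = 1 := by
    exact_mod_cast hmass
  rw [hsplit, hint, Complex.ofReal_mul, mul_add]
  generalize ((max (1 - 1 / c) 0 : ℝ) : ℂ) = p at *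
  generalize ((min 1 (1 / c) : ℝ) : ℂ) = q at *
  rw [← hmassC]
  push_cast
  generalize -m / (√c : ℂ) = w
  field_simp
  ring

theorem mp_stieltjes_selfconsistent (c : ℝ) (hc : 0 < c) (z : ℂ) (hz : 0 < z.im) :
    ((c : ℂ) * mpStieltjes c z) / (1 + (c : ℂ) * mpStieltjes c z) -
        z * ((c : ℂ) * mpStieltjes c z) = c ∧
      z * ((c : ℂ) * mpStieltjes c z) ^ 2 +
        (z - 1 + (c : ℂ)) * ((c : ℂ) * mpStieltjes c z) + (c : ℂ) = 0 := by
  obtain ⟨m, hq, hm⟩ := mul_mpStieltjes_eq hc hz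
  have hz0 : z ≠ 0 := by rintro rfl; simp at hz
  have h2 : (√c : ℂ) ^ 2 = c := by exact_mod_cast Real.sq_sqrt hc.le
  have h3 : (√c : ℂ) ≠ 0 := by exact_mod_cast (Real.sqrt_pos.2 hc).ne'
  set S := (c : ℂ) * mpStieltjes c z with hS
  have hzS : z * S = -(√c * m) - c := by
    rw [hS, mul_left_comm, hm, ← h2]
    field_simp
  have hquad : z * S ^ 2 + (z - 1 + c) * S + c = 0 := by
    refine mul_left_cancel₀ hz0 ?_
    linear_combination (z * S - √c * m - c + (z - 1 + c)) * hzS + √c * hq - h2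
  have hS1 : 1 + S ≠ 0 := by
    intro h
    have : (1 : ℂ) = 0 := by linear_combination hquad - (z * S + c - 1) * h
    exact one_ne_zero this
  refine ⟨?_, hquad⟩
  field_simp
  linear_combination -hquad
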